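/- Suppose A# ⊗̂ B# is approximately amenable and both A and B have bounded approximate identities. Then A ⊗̂ B is approximately amenable. -/

import Mathlib

open Filter Topology MeasureTheory

/-- A Banach bimodule structure over a (not necessarily unital) normed algebra `A`.
`l a x` is the left action `a • x` and `r a x` is the right action `x • a`. -/
structure BBimod (A X : Type*) [NonUnitalNormedRing A] [NormedSpace ℂ A]
    [NormedAddCommGroup X] [NormedSpace ℂ X] where
  l : A →L[ℂ] X →L[ℂ] X
  r : A →L[ℂ] X →L[ℂ] X
  l_mul : ∀ a b x, l (a * b) x = l a (l b x)
  r_mul : ∀ a b x, r (a * b) x = r b (r a x)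
  lr : ∀ a b x, l a (r b x) = r b (l a x)

namespace BBimod

variable {A X : Type*} [NonUnitalNormedRing A] [NormedSpace ℂ A]
    [NormedAddCommGroup X] [NormedSpace ℂ X]

/-- The dual bimodule structure on `X →L[ℂ] ℂ`:
`(a • f) x = f (x • a)` and `(f • a) x = f (a • x)`. -/
noncomputable def dual (M : BBimod A X) : BBimod A (X →L[ℂ] ℂ) where
  l := (ContinuousLinearMap.compL ℂ X X ℂ).flip.comp M.r
  r := (ContinuousLinearMap.compL ℂ X X ℂ).flip.comp M.l
  l_mul := by intro a b f; ext x; simp [M.r_mul a b x]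
  r_mul := by intro a b f; ext x; simp [M.l_mul a b x]
  lr := by intro a b f; ext x; simp [M.lr]

/-- `D` is a derivation: `D (a b) = a • D b + D a • b`. -/
def IsDeriv (M : BBimod A X) (D : A →L[ℂ] X) : Prop :=
  ∀ a b, D (a * b) = M.l a (D b) + M.r b (D a)

/-- `D` is inner: `D a = a • x - x • a` for some `x`. -/
def IsInner (M : BBimod A X) (D : A →L[ℂ] X) : Prop :=
  ∃ x, ∀ a, D a = M.l a x - M.r a x

/-- `D` is approximately inner: a net of inner derivations converges to `D`
in the strong operator topology. -/
def IsApproxInner (M : BBimod A X) (D : A →L[ℂ] X) : Prop :=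
  ∃ (ι : Type) (lf : Filter ι) (x : ι → X), lf.NeBot ∧
    ∀ a, Tendsto (fun i => M.l a (x i) - M.r a (x i)) lf (𝓝 (D a))

/-- `D` is boundedly approximately inner: the approximating net of inner derivations
is uniformly bounded in operator norm. -/
def IsBddApproxInner (M : BBimod A X) (D : A →L[ℂ] X) : Prop :=
  ∃ (ι : Type) (lf : Filter ι) (x : ι → X) (K : ℝ), lf.NeBot ∧
    (∀ i a, ‖M.l a (x i) - M.r a (x i)‖ ≤ K * ‖a‖) ∧
    ∀ a, Tendsto (fun i => M.l a (x i) - M.r a (x i)) lf (𝓝 (D a))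

/-- `D` is approximately semi-inner: `D a = lim_i (a • m i - n i • a)`. -/
def IsApproxSemiInner (M : BBimod A X) (D : A →L[ℂ] X) : Prop :=
  ∃ (ι : Type) (lf : Filter ι) (m n : ι → X), lf.NeBot ∧
    ∀ a, Tendsto (fun i => M.l a (m i) - M.r a (n i)) lf (𝓝 (D a))

/-- The bimodule `X` is neo-unital: `X = A • X • A`. -/
def NeoUnital (M : BBimod A X) : Prop :=
  ∀ x : X, ∃ a b y, x = M.l a (M.r b y)

/-- A derivation into the dual module is boundedly weak*-approximately inner. -/
def IsBddWeakStarApproxInner (M : BBimod A X) (D : A →L[ℂ] (X →L[ℂ] ℂ)) : Prop :=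
  ∃ (ι : Type) (lf : Filter ι) (f : ι → (X →L[ℂ] ℂ)) (K : ℝ), lf.NeBot ∧
    (∀ i, ‖f i‖ ≤ K) ∧
    ∀ (a : A) (x : X),
      Tendsto (fun i => (M.dual.l a (f i) - M.dual.r a (f i)) x) lf (𝓝 (D a x))

end BBimod

/-- A Banach algebra is approximately amenable if every continuous derivation into
the dual of a Banach bimodule is approximately inner. -/
def ApproxAmenable (A : Type*) [NonUnitalNormedRing A] [NormedSpace ℂ A] : Prop :=
  ∀ (X : Type) [NormedAddCommGroup X] [NormedSpace ℂ X] [CompleteSpace X]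
    (M : BBimod A X) (D : A →L[ℂ] (X →L[ℂ] ℂ)),
    M.dual.IsDeriv D → M.dual.IsApproxInner D

/-- A Banach algebra is boundedly approximately amenable if every continuous derivation
into the dual of a Banach bimodule is boundedly approximately inner. -/
def BddApproxAmenable (A : Type*) [NonUnitalNormedRing A] [NormedSpace ℂ A] : Prop :=
  ∀ (X : Type) [NormedAddCommGroup X] [NormedSpace ℂ X] [CompleteSpace X]
    (M : BBimod A X) (D : A →L[ℂ] (X →L[ℂ] ℂ)),
    M.dual.IsDeriv D → M.dual.IsBddApproxInner D

/-- A Banach algebra is boundedly approximately contractible if every continuous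
derivation into any Banach bimodule is boundedly approximately inner. -/
def BddApproxContractible (A : Type*) [NonUnitalNormedRing A] [NormedSpace ℂ A] : Prop :=
  ∀ (X : Type) [NormedAddCommGroup X] [NormedSpace ℂ X] [CompleteSpace X]
    (M : BBimod A X) (D : A →L[ℂ] X),
    M.IsDeriv D → M.IsBddApproxInner D

/-- A Banach algebra is amenable if every continuous derivation into the dual of a
Banach bimodule is inner. -/
def Amenable (A : Type*) [NonUnitalNormedRing A] [NormedSpace ℂ A] : Prop :=
  ∀ (X : Type) [NormedAddCommGroup X] [NormedSpace ℂ X] [CompleteSpace X]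
    (M : BBimod A X) (D : A →L[ℂ] (X →L[ℂ] ℂ)),
    M.dual.IsDeriv D → M.dual.IsInner D

/-- `A` has a bounded (two-sided) approximate identity. -/
def HasBAI (A : Type*) [NonUnitalNormedRing A] : Prop :=
  ∃ (ι : Type) (lf : Filter ι) (e : ι → A) (K : ℝ), lf.NeBot ∧
    (∀ i, ‖e i‖ ≤ K) ∧
    ∀ a : A, Tendsto (fun i => e i * a) lf (𝓝 a) ∧ Tendsto (fun i => a * e i) lf (𝓝 a)

/-- A witness that the Banach algebra `C` is (isometrically isomorphic to) the projective
tensor product `A ⊗̂ B`: a contractive bilinear multiplicative map with dense span satisfying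
the universal property of the projective tensor norm. -/
structure ProjTensor (A B C : Type*) [NonUnitalNormedRing A] [NormedSpace ℂ A]
    [NonUnitalNormedRing B] [NormedSpace ℂ B]
    [NonUnitalNormedRing C] [NormedSpace ℂ C] where
  tp : A →L[ℂ] B →L[ℂ] C
  mk_mul : ∀ a a' b b', tp (a * a') (b * b') = tp a b * tp a' b'
  norm_mk_le : ∀ a b, ‖tp a b‖ ≤ ‖a‖ * ‖b‖
  dense_span : Dense
    ((Submodule.span ℂ (Set.range fun p : A × B => tp p.1 p.2) : Submodule ℂ C) : Set C)
  lift : ∀ (E : Type) [NormedAddCommGroup E] [NormedSpace ℂ E] [CompleteSpace E]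
    (φ : A →L[ℂ] B →L[ℂ] E), ∃ T : C →L[ℂ] E, ‖T‖ ≤ ‖φ‖ ∧ ∀ a b, T (tp a b) = φ a b

/-- A witness that the Banach space `T` is the projective tensor product `E ⊗̂ F`
of Banach spaces. -/
structure ProjTensorSp (E F T : Type*) [NormedAddCommGroup E] [NormedSpace ℂ E]
    [NormedAddCommGroup F] [NormedSpace ℂ F]
    [NormedAddCommGroup T] [NormedSpace ℂ T] where
  tp : E →L[ℂ] F →L[ℂ] T
  norm_mk_le : ∀ e f, ‖tp e f‖ ≤ ‖e‖ * ‖f‖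
  dense_span : Dense
    ((Submodule.span ℂ (Set.range fun p : E × F => tp p.1 p.2) : Submodule ℂ T) : Set T)
  lift : ∀ (W : Type) [NormedAddCommGroup W] [NormedSpace ℂ W] [CompleteSpace W]
    (φ : E →L[ℂ] F →L[ℂ] W), ∃ S : T →L[ℂ] W, ‖S‖ ≤ ‖φ‖ ∧ ∀ e f, S (tp e f) = φ e f

/-- A witness that the unital Banach algebra `A'` is the unitization `A#` of `A`. -/
structure IsUnitization (A A' : Type*) [NonUnitalNormedRing A] [NormedSpace ℂ A]
    [NormedRing A'] [NormedAlgebra ℂ A'] where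
  ι : A →L[ℂ] A'
  ι_mul : ∀ a b, ι (a * b) = ι a * ι b
  ι_norm : ∀ a, ‖ι a‖ = ‖a‖
  decomp : ∀ x : A', ∃! p : ℂ × A, x = algebraMap ℂ A' p.1 + ι p.2


section limits

variable {ι F X V : Type*} [NormedAddCommGroup F] [NormedSpace ℂ F]
  [NormedAddCommGroup X] [NormedSpace ℂ X] [NormedAddCommGroup V] [NormedSpace ℂ V]

theorem limOp1 {lf : Filter ι} [lf.NeBot] (T : ι → X →L[ℂ] V) (K : ℝ)
    (hK : ∀ i, ‖T i‖ ≤ K) (hc : ∀ x, ∃ v, Tendsto (fun i => T i x) lf (𝓝 v)) :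
    ∃ L : X →L[ℂ] V, ‖L‖ ≤ K ∧ ∀ x, Tendsto (fun i => T i x) lf (𝓝 (L x)) := by
  choose g hg using hc
  have hK0 : 0 ≤ K := by
    obtain ⟨i⟩ := lf.nonempty_of_neBot
    exact (norm_nonneg _).trans (hK i)
  let L : X →ₗ[ℂ] V :=
    { toFun := g
      map_add' := fun x y => by
        refine tendsto_nhds_unique (hg (x + y)) ?_
        simpa using (hg x).add (hg y)
      map_smul' := fun c x => by
        refine tendsto_nhds_unique (hg (c • x)) ?_
        simpa using (hg x).const_smul c }
  refine ⟨L.mkContinuous K fun x => ?_, L.mkContinuous_norm_le hK0 _, fun x => hg x⟩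
  refine le_of_tendsto (hg x).norm (Eventually.of_forall fun i => ?_)
  exact (T i).le_of_opNorm_le (hK i) x

theorem limOp2 {lf : Filter ι} [lf.NeBot] (T : ι → F →L[ℂ] X →L[ℂ] V) (K : ℝ)
    (hK : ∀ i, ‖T i‖ ≤ K) (hc : ∀ f x, ∃ v, Tendsto (fun i => T i f x) lf (𝓝 v)) :
    ∃ L : F →L[ℂ] X →L[ℂ] V, ∀ f x, Tendsto (fun i => T i f x) lf (𝓝 (L f x)) := by
  have h1 : ∀ f, ∃ L : X →L[ℂ] V, ‖L‖ ≤ K * ‖f‖ ∧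
      ∀ x, Tendsto (fun i => T i f x) lf (𝓝 (L x)) := fun f =>
    limOp1 (fun i => T i f) (K * ‖f‖) (fun i => (T i).le_of_opNorm_le (hK i) f) (hc f)
  choose g hgK hg using h1
  let L : F →ₗ[ℂ] X →L[ℂ] V :=
    { toFun := g
      map_add' := fun x y => by
        ext v
        refine tendsto_nhds_unique (hg (x + y) v) ?_
        simpa using (hg x v).add (hg y v)
      map_smul' := fun c x => by
        ext v
        refine tendsto_nhds_unique (hg (c • x) v) ?_
        simpa using (hg x v).const_smul c }
  exact ⟨L.mkContinuous K hgK, fun f x => hg f x⟩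

/-- Pointwise convergence of a bounded net of operators on a dense set gives convergence. -/
theorem exists_lim_of_dense [CompleteSpace V] {lf : Filter ι} [lf.NeBot]
    (T : ι → X →L[ℂ] V) (K : ℝ)
    (hK : ∀ i, ‖T i‖ ≤ K) (G : Set X) (hG : Dense G)
    (hc : ∀ x ∈ G, ∃ v, Tendsto (fun i => T i x) lf (𝓝 v)) (x : X) :
    ∃ v, Tendsto (fun i => T i x) lf (𝓝 v) := by
  have hK0 : 0 ≤ K := by
    obtain ⟨i⟩ := lf.nonempty_of_neBot
    exact (norm_nonneg _).trans (hK i)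
  have : Cauchy (map (fun i => T i x) lf) := by
    rw [Metric.cauchy_iff]
    refine ⟨inferInstance, fun ε hε => ?_⟩
    obtain ⟨g, hg, hxg⟩ := hG.exists_dist_lt x (ε := ε / (4 * (K + 1))) (by positivity)
    obtain ⟨v, hv⟩ := hc g hg
    have hb : ∀ i, dist (T i x) (T i g) ≤ ε / 4 := fun i => by
      rw [dist_eq_norm, ← map_sub]
      rw [dist_eq_norm] at hxg
      calc ‖T i (x - g)‖ ≤ K * ‖x - g‖ := (T i).le_of_opNorm_le (hK i) _
        _ ≤ (K + 1) * (ε / (4 * (K + 1))) := by gcongr; linarith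
        _ = ε / 4 := by field_simp
    refine ⟨(fun i => T i x) '' {i | dist (T i g) v < ε / 4},
      image_mem_map (hv (Metric.ball_mem_nhds _ (by positivity))), ?_⟩
    rintro _ ⟨i, hi, rfl⟩ _ ⟨j, hj, rfl⟩
    have h1 := hb i
    have h2 := hb j
    simp only [Set.mem_setOf_eq] at hi hj
    have h3 := dist_triangle4 (T i x) (T i g) (T j g) (T j x)
    have h4 := dist_triangle_right (T i g) (T j g) v
    rw [dist_comm (T j g) (T j x)] at h3
    linarith
  obtain ⟨v, hv⟩ := CompleteSpace.complete this
  exact ⟨v, hv⟩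

theorem exists_ulim (U : Ultrafilter ι) (f : ι → ℂ) (K : ℝ) (hK : ∀ i, ‖f i‖ ≤ K) :
    ∃ v, Tendsto f U (𝓝 v) := by
  have hc : IsCompact (Metric.closedBall (0 : ℂ) K) := isCompact_closedBall _ _
  obtain ⟨v, -, hv⟩ := isCompact_iff_ultrafilter_le_nhds.1 hc (U.map f) (by
    rw [le_principal_iff]
    exact Filter.mem_map.2 (Filter.univ_mem' fun i => by simpa using hK i))
  exact ⟨v, hv⟩

/-- a bounded net of operators applied to a null net -/
theorem tendsto_bdd_apply_zero {lf : Filter ι} (T : ι → X →L[ℂ] V) (K : ℝ)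
    (hK : ∀ i, ‖T i‖ ≤ K) (u : ι → X) (hu : Tendsto u lf (𝓝 0)) :
    Tendsto (fun i => T i (u i)) lf (𝓝 0) := by
  refine squeeze_zero_norm (a := fun i => K * ‖u i‖)
    (fun i => (T i).le_of_opNorm_le (hK i) _) ?_
  simpa using (hu.norm.const_mul K)

/-- strong convergence plus boundedness: `T i (u i) → L x`. -/
theorem tendsto_bdd_apply {lf : Filter ι} (T : ι → X →L[ℂ] V) (K : ℝ)
    (hK : ∀ i, ‖T i‖ ≤ K) (u : ι → X) (x : X) (v : V) (hu : Tendsto u lf (𝓝 x))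
    (hT : Tendsto (fun i => T i x) lf (𝓝 v)) :
    Tendsto (fun i => T i (u i)) lf (𝓝 v) := by
  have h := tendsto_bdd_apply_zero T K hK (fun i => u i - x)
    (by simpa using hu.sub_const x)
  simpa using h.add hT

theorem exists_dual_lim (U : Ultrafilter ι) (p : ι → X →L[ℂ] V) (K : ℝ) (hK : ∀ i, ‖p i‖ ≤ K) :
    ∃ σ : (V →L[ℂ] ℂ) →L[ℂ] X →L[ℂ] ℂ,
      ∀ f x, Tendsto (fun i => f (p i x)) U (𝓝 (σ f x)) := by
  have hK0 : 0 ≤ K := by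
    obtain ⟨i⟩ := (U : Filter ι).nonempty_of_neBot
    exact (norm_nonneg _).trans (hK i)
  have bT : ∀ i, ‖(ContinuousLinearMap.compL ℂ X V ℂ).flip (p i)‖ ≤ K := fun i => by
    refine ContinuousLinearMap.opNorm_le_bound _ hK0 fun f => ?_
    change ‖f ∘L p i‖ ≤ _
    refine (ContinuousLinearMap.opNorm_comp_le _ _).trans ?_
    rw [mul_comm]
    gcongr
    exact hK i
  exact limOp2 (lf := (U : Filter ι)) _ _ bT (fun f x =>
    exists_ulim U _ (K * ‖f‖ * ‖x‖) (fun i =>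
      ContinuousLinearMap.le_of_opNorm_le _ (ContinuousLinearMap.le_of_opNorm_le _ (bT i) f) x))

/-- Auxiliary bilinear map used to tensor operators. -/
theorem exists_post {P Q Z : Type*} [NormedAddCommGroup P] [NormedSpace ℂ P]
    [NormedAddCommGroup Q] [NormedSpace ℂ Q]
    [NormedAddCommGroup Z] [NormedSpace ℂ Z]
    (S : P →L[ℂ] F →L[ℂ] F) (T : Q →L[ℂ] X →L[ℂ] X) (b : F →L[ℂ] X →L[ℂ] V)
    (L : (F →L[ℂ] X →L[ℂ] V) →L[ℂ] Z) :
    ∃ G : P →L[ℂ] Q →L[ℂ] Z, ∀ p q, ∃ φ : F →L[ℂ] X →L[ℂ] V, G p q = L φ ∧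
      ∀ f x, φ f x = b (S p f) (T q x) := by
  let P' : P →L[ℂ] (F →L[ℂ] X →L[ℂ] V) := (ContinuousLinearMap.compL ℂ F F (X →L[ℂ] V) b) ∘L S
  let R : Q →L[ℂ] ((X →L[ℂ] V) →L[ℂ] (X →L[ℂ] V)) :=
    (ContinuousLinearMap.compL ℂ X X V).flip ∘L T
  let G : P →L[ℂ] Q →L[ℂ] (F →L[ℂ] X →L[ℂ] V) :=
    ((ContinuousLinearMap.compL ℂ F (X →L[ℂ] V) (X →L[ℂ] V)).bilinearComp R P').flip
  exact ⟨(ContinuousLinearMap.compL ℂ Q (F →L[ℂ] X →L[ℂ] V) Z L) ∘L G, fun p q => ⟨G p q, rfl, fun f x => rfl⟩⟩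

theorem li_closed [CompleteSpace X] (I : X →ₗᵢ[ℂ] V) : IsClosed (Set.range I) :=
  I.isometry.isClosedEmbedding.isClosed_range

end limits

section abstractPart

/-- A bounded approximate identity along a filter. -/
structure BAI {A ι : Type*} [NonUnitalNormedRing A] (lf : Filter ι) (e : ι → A) (K : ℝ) :
    Prop where
  bdd : ∀ i, ‖e i‖ ≤ K
  left : ∀ a, Tendsto (fun i => e i * a) lf (𝓝 a)
  right : ∀ a, Tendsto (fun i => a * e i) lf (𝓝 a)

variable {C C₀ : Type*} [NonUnitalNormedRing C] [NormedSpace ℂ C]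
    [NonUnitalNormedRing C₀] [NormedSpace ℂ C₀]

/-- `C` acts on `C₀` by double multipliers, compatibly with a map `C₀ → C`. -/
structure MultAct (N : BBimod C C₀) (J : C₀ →L[ℂ] C) : Prop where
  h1 : ∀ c x y, N.l c (x * y) = N.l c x * y
  h2 : ∀ c x y, N.r c (x * y) = x * N.r c y
  h3 : ∀ c x y, x * N.l c y = N.r c x * y
  jl : ∀ x y, N.l (J x) y = x * y
  jr : ∀ x y, N.r (J x) y = y * x

theorem dual_l_apply {X : Type*} [NormedAddCommGroup X] [NormedSpace ℂ X]
    (M : BBimod C X) (c : C) (f : X →L[ℂ] ℂ) (x : X) : M.dual.l c f x = f (M.r c x) := rfl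

theorem dual_r_apply {X : Type*} [NormedAddCommGroup X] [NormedSpace ℂ X]
    (M : BBimod C X) (c : C) (f : X →L[ℂ] ℂ) (x : X) : M.dual.r c f x = f (M.l c x) := rfl

theorem ess_case {ι : Type*} {lf : Filter ι} [lf.NeBot] {e : ι → C₀} {K : ℝ}
    (he : BAI lf e K)
    {N : BBimod C C₀} {J : C₀ →L[ℂ] C} (hN : MultAct N J) (h : ApproxAmenable C)
    (X : Type) [NormedAddCommGroup X] [NormedSpace ℂ X] [CompleteSpace X]
    (M : BBimod C₀ X) (hl : ∀ x, Tendsto (fun i => M.l (e i) x) lf (𝓝 x))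
    (hr : ∀ x, Tendsto (fun i => M.r (e i) x) lf (𝓝 x))
    (D : C₀ →L[ℂ] (X →L[ℂ] ℂ)) (hD : M.dual.IsDeriv D) : M.dual.IsApproxInner D := by
  have hK0 : 0 ≤ K := by
    obtain ⟨i⟩ := lf.nonempty_of_neBot
    exact (norm_nonneg _).trans (he.bdd i)
  have hD' : ∀ a b x, D (a * b) x = D b (M.r a x) + D a (M.l b x) := fun a b x => by
    rw [hD a b]; rfl
  -- density
  have dl : Dense {v : X | ∃ x u, v = M.l x u} := fun v =>
    mem_closure_of_tendsto (hl v) (Eventually.of_forall fun i => ⟨e i, v, rfl⟩)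
  have dr : Dense {v : X | ∃ x u, v = M.r x u} := fun v =>
    mem_closure_of_tendsto (hr v) (Eventually.of_forall fun i => ⟨e i, v, rfl⟩)
  have dlr : Dense {v : X | ∃ x y u, v = M.l x (M.r y u)} := fun v => by
    refine mem_closure_of_tendsto (tendsto_bdd_apply (fun i => M.l (e i)) (‖M.l‖ * K)
      (fun i => M.l.le_opNorm_of_le (he.bdd i)) (fun i => M.r (e i) v) v v (hr v) (hl v))
      (Eventually.of_forall fun i => ⟨e i, e i, v, rfl⟩)
  -- left action
  have bl : ∀ i, ‖M.l ∘L N.l.flip (e i)‖ ≤ ‖M.l‖ * (‖N.l‖ * K) := fun i => by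
    refine (ContinuousLinearMap.opNorm_comp_le _ _).trans ?_
    gcongr
    refine (N.l.flip.le_opNorm_of_le (he.bdd i)).trans ?_
    rw [ContinuousLinearMap.opNorm_flip]
  have cl : ∀ c x u, Tendsto (fun i => (M.l ∘L N.l.flip (e i)) c (M.l x u)) lf
      (𝓝 (M.l (N.l c x) u)) := fun c x u => by
    have : ∀ i, (M.l ∘L N.l.flip (e i)) c (M.l x u) = M.l (N.l c (e i * x)) u := fun i => by
      simp [hN.h1, M.l_mul]
    simp only [this]
    have hcont : Continuous fun y => M.l (N.l c y) u := by fun_prop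
    exact (hcont.tendsto x).comp (he.left x)
  obtain ⟨L, hL⟩ := limOp2 (lf := lf) (fun i => M.l ∘L N.l.flip (e i)) _ bl (fun c v =>
    exists_lim_of_dense (fun i => (M.l ∘L N.l.flip (e i)) c) (‖M.l‖ * (‖N.l‖ * K) * ‖c‖)
      (fun i => ContinuousLinearMap.le_of_opNorm_le _ (bl i) c) _ dl
      (by rintro _ ⟨x, u, rfl⟩; exact ⟨_, cl c x u⟩) v)
  have hLl : ∀ c x u, L c (M.l x u) = M.l (N.l c x) u := fun c x u =>
    tendsto_nhds_unique (hL c _) (cl c x u)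
  -- right action
  have br : ∀ i, ‖M.r ∘L N.r.flip (e i)‖ ≤ ‖M.r‖ * (‖N.r‖ * K) := fun i => by
    refine (ContinuousLinearMap.opNorm_comp_le _ _).trans ?_
    gcongr
    refine (N.r.flip.le_opNorm_of_le (he.bdd i)).trans ?_
    rw [ContinuousLinearMap.opNorm_flip]
  have cr : ∀ c x u, Tendsto (fun i => (M.r ∘L N.r.flip (e i)) c (M.r x u)) lf
      (𝓝 (M.r (N.r c x) u)) := fun c x u => by
    have : ∀ i, (M.r ∘L N.r.flip (e i)) c (M.r x u) = M.r (N.r c (x * e i)) u := fun i => by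
      simp [hN.h2, M.r_mul]
    simp only [this]
    have hcont : Continuous fun y => M.r (N.r c y) u := by fun_prop
    exact (hcont.tendsto x).comp (he.right x)
  obtain ⟨R, hR⟩ := limOp2 (lf := lf) (fun i => M.r ∘L N.r.flip (e i)) _ br (fun c v =>
    exists_lim_of_dense (fun i => (M.r ∘L N.r.flip (e i)) c) (‖M.r‖ * (‖N.r‖ * K) * ‖c‖)
      (fun i => ContinuousLinearMap.le_of_opNorm_le _ (br i) c) _ dr
      (by rintro _ ⟨x, u, rfl⟩; exact ⟨_, cr c x u⟩) v)
  have hRr : ∀ c x u, R c (M.r x u) = M.r (N.r c x) u := fun c x u =>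
    tendsto_nhds_unique (hR c _) (cr c x u)
  have hRl : ∀ c x y u, R c (M.l x (M.r y u)) = M.l x (M.r (N.r c y) u) := fun c x y u => by
    rw [M.lr, hRr, M.lr]
  have ext_l : ∀ S T : X →L[ℂ] X, (∀ x u, S (M.l x u) = T (M.l x u)) → ∀ v, S v = T v :=
    fun S T hST v => congrFun (Continuous.ext_on dl S.continuous T.continuous
      (by rintro _ ⟨x, u, rfl⟩; exact hST x u)) v
  have ext_r : ∀ S T : X →L[ℂ] X, (∀ x u, S (M.r x u) = T (M.r x u)) → ∀ v, S v = T v :=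
    fun S T hST v => congrFun (Continuous.ext_on dr S.continuous T.continuous
      (by rintro _ ⟨x, u, rfl⟩; exact hST x u)) v
  have ext_lr : ∀ {V : Type} [NormedAddCommGroup V] [NormedSpace ℂ V] (S T : X →L[ℂ] V),
      (∀ x y u, S (M.l x (M.r y u)) = T (M.l x (M.r y u))) → ∀ v, S v = T v :=
    fun S T hST v => congrFun (Continuous.ext_on dlr S.continuous T.continuous
      (by rintro _ ⟨x, y, u, rfl⟩; exact hST x y u)) v
  let M' : BBimod C X :=
    { l := L
      r := R
      l_mul := fun a b v => ext_l (L (a * b)) (L a ∘L L b)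
        (fun x u => by simp [hLl, N.l_mul]) v
      r_mul := fun a b v => ext_r (R (a * b)) (R b ∘L R a)
        (fun x u => by simp [hRr, N.r_mul]) v
      lr := fun a b v => ext_lr (L a ∘L R b) (R b ∘L L a)
        (fun x y u => by simp [hLl, hRl]) v }
  -- the extended derivation
  have bd : ∀ i, ‖D ∘L N.l.flip (e i)‖ ≤ ‖D‖ * (‖N.l‖ * K) := fun i => by
    refine (ContinuousLinearMap.opNorm_comp_le _ _).trans ?_
    gcongr
    refine (N.l.flip.le_opNorm_of_le (he.bdd i)).trans ?_
    rw [ContinuousLinearMap.opNorm_flip]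
  have cd : ∀ c x y u, Tendsto (fun i => (D ∘L N.l.flip (e i)) c (M.l x (M.r y u))) lf
      (𝓝 (D (N.l c x) (M.r y u) - D x (M.r (N.r c y) u))) := fun c x y u => by
    have : ∀ i, (D ∘L N.l.flip (e i)) c (M.l x (M.r y u)) =
        D (N.l c (e i * x)) (M.r y u) - D x (M.r (N.r c y * e i) u) := fun i => by
      rw [hN.h1, hD', ← hN.h3, M.r_mul]
      simp
    simp only [this]
    have hc1 : Continuous fun z => D (N.l c z) (M.r y u) := by fun_prop
    have hc2 : Continuous fun z => D x (M.r z u) := by fun_prop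
    exact ((hc1.tendsto x).comp (he.left x)).sub ((hc2.tendsto _).comp (he.right (N.r c y)))
  obtain ⟨D', hD1⟩ := limOp2 (lf := lf) (fun i => D ∘L N.l.flip (e i)) _ bd (fun c v =>
    exists_lim_of_dense (fun i => (D ∘L N.l.flip (e i)) c) (‖D‖ * (‖N.l‖ * K) * ‖c‖)
      (fun i => ContinuousLinearMap.le_of_opNorm_le _ (bd i) c) _ dlr
      (by rintro _ ⟨x, y, u, rfl⟩; exact ⟨_, cd c x y u⟩) v)
  have hDv : ∀ c x y u, D' c (M.l x (M.r y u)) =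
      D (N.l c x) (M.r y u) - D x (M.r (N.r c y) u) := fun c x y u =>
    tendsto_nhds_unique (hD1 c _) (cd c x y u)
  have hder : M'.dual.IsDeriv D' := by
    intro c d
    ext v
    refine ext_lr (D' (c * d)) (D' d ∘L R c + D' c ∘L L d) (fun x y u => ?_) v
    simp only [ContinuousLinearMap.add_apply, ContinuousLinearMap.comp_apply, hRl, hLl, hDv,
      N.l_mul, N.r_mul]
    ring
  obtain ⟨κ, lk, φ, hk, hφ⟩ := h X M' D' hder
  refine ⟨κ, lk, φ, hk, fun a => ?_⟩
  have e1 : ∀ v, L (J a) v = M.l a v := ext_l _ _ fun x u => by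
    rw [hLl, hN.jl, M.l_mul]
  have e2 : ∀ v, R (J a) v = M.r a v := ext_r _ _ fun x u => by
    rw [hRr, hN.jr, M.r_mul]
  have e3 : D' (J a) = D a := by
    ext v
    refine ext_lr _ _ (fun x y u => ?_) v
    rw [hDv, hN.jl, hN.jr, hD', M.r_mul]
    ring
  have := hφ (J a)
  rw [e3] at this
  convert this using 2 with k
  ext v
  simp only [ContinuousLinearMap.sub_apply, dual_l_apply, dual_r_apply]
  rw [← e1, ← e2]

set_option synthInstance.maxHeartbeats 400000 in
set_option maxHeartbeats 1000000 in
theorem abstract_main {ι : Type*} {lf : Filter ι} [lf.NeBot] {e : ι → C₀} {K : ℝ}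
    (he : BAI lf e K)
    {N : BBimod C C₀} {J : C₀ →L[ℂ] C} (hN : MultAct N J) (h : ApproxAmenable C) :
    ApproxAmenable C₀ := by
  intro X _ _ _ M D hD
  have hK0 : 0 ≤ K := by
    obtain ⟨i⟩ := lf.nonempty_of_neBot
    exact (norm_nonneg _).trans (he.bdd i)
  have hD' : ∀ a b x, D (a * b) x = D b (M.r a x) + D a (M.l b x) := fun a b x => by
    rw [hD a b]; rfl
  have bl : ∀ i, ‖M.l (e i)‖ ≤ ‖M.l‖ * K := fun i => M.l.le_opNorm_of_le (he.bdd i)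
  have br : ∀ i, ‖M.r (e i)‖ ≤ ‖M.r‖ * K := fun i => M.r.le_opNorm_of_le (he.bdd i)
  have cll : ∀ a x, Tendsto (fun i => M.l (e i) (M.l a x)) lf (𝓝 (M.l a x)) := fun a x => by
    simp only [← M.l_mul]
    have hc : Continuous fun z => M.l z x := by fun_prop
    exact (hc.tendsto a).comp (he.left a)
  have crr : ∀ a x, Tendsto (fun i => M.r (e i) (M.r a x)) lf (𝓝 (M.r a x)) := fun a x => by
    simp only [← M.r_mul]
    have hc : Continuous fun z => M.r z x := by fun_prop
    exact (hc.tendsto a).comp (he.right a)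
  -- the essential part
  let W : Submodule ℂ X :=
    { carrier := {x | Tendsto (fun i => M.l (e i) x) lf (𝓝 x) ∧
        Tendsto (fun i => M.r (e i) x) lf (𝓝 x)}
      add_mem' := fun {x y} hx hy => by
        constructor
        · simpa using hx.1.add hy.1
        · simpa using hx.2.add hy.2
      zero_mem' := by constructor <;> simp
      smul_mem' := fun c x hx => by
        constructor
        · simpa using hx.1.const_smul c
        · simpa using hx.2.const_smul c }
  have closed_aux : ∀ (T : ι → X →L[ℂ] X) (B : ℝ), (∀ i, ‖T i‖ ≤ B) →
      IsClosed {x | Tendsto (fun i => T i x) lf (𝓝 x)} := by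
    intro T B hB
    have hB0 : 0 ≤ B := by
      obtain ⟨i⟩ := lf.nonempty_of_neBot
      exact (norm_nonneg _).trans (hB i)
    refine isClosed_of_closure_subset fun x hx => ?_
    rw [Set.mem_setOf_eq, Metric.tendsto_nhds]
    intro ε hε
    obtain ⟨y, hy, hxy⟩ := Metric.mem_closure_iff.1 hx (ε / (2 * (B + 1))) (by positivity)
    have h2 : (B + 1) * dist x y < ε / 2 := by
      calc (B + 1) * dist x y < (B + 1) * (ε / (2 * (B + 1))) := by gcongr
        _ = ε / 2 := by field_simp
    filter_upwards [Metric.tendsto_nhds.1 hy (ε / 2) (by positivity)] with i hi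
    have h1 : dist (T i x) (T i y) ≤ B * dist x y := by
      rw [dist_eq_norm, ← map_sub, dist_eq_norm]
      exact (T i).le_of_opNorm_le (hB i) _
    have h3 := dist_triangle4 (T i x) (T i y) y x
    rw [dist_comm y x] at h3
    linarith
  have hWc : IsClosed (W : Set X) := (closed_aux _ _ bl).inter (closed_aux _ _ br)
  haveI : CompleteSpace W := hWc.completeSpace_coe
  have hWl : ∀ a, ∀ x ∈ W, M.l a x ∈ W := fun a x hx => by
    refine ⟨cll a x, ?_⟩
    simp only [← M.lr]
    exact ((M.l a).continuous.tendsto x).comp hx.2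
  have hWr : ∀ a, ∀ x ∈ W, M.r a x ∈ W := fun a x hx => by
    refine ⟨?_, crr a x⟩
    simp only [M.lr]
    exact ((M.r a).continuous.tendsto x).comp hx.1
  have hWlr : ∀ a b x, M.l a (M.r b x) ∈ W := fun a b x => by
    refine ⟨cll a _, ?_⟩
    rw [M.lr]
    exact crr b _
  -- restricted module
  let lW : C₀ →L[ℂ] W →L[ℂ] W := LinearMap.mkContinuous₂
    (LinearMap.mk₂ ℂ (fun a (w : W) => (⟨M.l a w, hWl a w w.2⟩ : W))
      (fun a b w => by ext; simp) (fun c a w => by ext; simp)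
      (fun a v w => by ext; simp) (fun c a w => by ext; simp)) ‖M.l‖
    (fun a w => M.l.le_opNorm₂ a (w : X))
  let rW : C₀ →L[ℂ] W →L[ℂ] W := LinearMap.mkContinuous₂
    (LinearMap.mk₂ ℂ (fun a (w : W) => (⟨M.r a w, hWr a w w.2⟩ : W))
      (fun a b w => by ext; simp) (fun c a w => by ext; simp)
      (fun a v w => by ext; simp) (fun c a w => by ext; simp)) ‖M.r‖
    (fun a w => M.r.le_opNorm₂ a (w : X))
  have lW_coe : ∀ a w, ((lW a w : W) : X) = M.l a w := fun a w => rfl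
  have rW_coe : ∀ a w, ((rW a w : W) : X) = M.r a w := fun a w => rfl
  let MW : BBimod C₀ W :=
    { l := lW
      r := rW
      l_mul := fun a b w => Subtype.ext (M.l_mul a b w)
      r_mul := fun a b w => Subtype.ext (M.r_mul a b w)
      lr := fun a b w => Subtype.ext (M.lr a b w) }
  let res : (X →L[ℂ] ℂ) →L[ℂ] (W →L[ℂ] ℂ) := (ContinuousLinearMap.compL ℂ W X ℂ).flip W.subtypeL
  have res_apply : ∀ f w, res f w = f (w : X) := fun f w => rfl
  obtain ⟨κ, lk, φ, hk, hφ⟩ := ess_case he hN h W MW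
    (fun w => tendsto_subtype_rng.2 w.2.1) (fun w => tendsto_subtype_rng.2 w.2.2)
    (res ∘L D) (fun a b => by
      ext w
      exact hD' a b w)
  -- the splitting map
  let U : Ultrafilter ι := Ultrafilter.of lf
  have hU : (U : Filter ι) ≤ lf := Ultrafilter.of_le lf
  let p : ι → X →L[ℂ] W := fun i => (M.l (e i) ∘L M.r (e i)).codRestrict W (fun x => hWlr _ _ x)
  have p_coe : ∀ i x, ((p i x : W) : X) = M.l (e i) (M.r (e i) x) := fun i x => rfl
  have bp : ∀ i, ‖p i‖ ≤ (‖M.l‖ * K) * (‖M.r‖ * K) := fun i => by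
    refine ContinuousLinearMap.opNorm_le_bound _ (by positivity) fun x => ?_
    change ‖M.l (e i) (M.r (e i) x)‖ ≤ _
    calc _ ≤ (‖M.l‖ * K) * ((‖M.r‖ * K) * ‖x‖) :=
          (M.l (e i)).le_of_opNorm_le_of_le (bl i) ((M.r (e i)).le_of_opNorm_le (br i) x)
      _ = _ := by ring
  obtain ⟨σ, hσ⟩ := exists_dual_lim U p _ bp
  have σ_res : ∀ f (w : W), σ f w = f w := fun f w => by
    refine tendsto_nhds_unique (hσ f w) ?_
    have : Tendsto (fun i => p i w) lf (𝓝 w) := tendsto_subtype_rng.2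
      (tendsto_bdd_apply (fun i => M.l (e i)) _ bl (fun i => M.r (e i) w) w w w.2.2 w.2.1)
    exact ((f.continuous.tendsto w).comp this).mono_left hU
  have comm0 : ∀ a, Tendsto (fun i => e i * a - a * e i) lf (𝓝 0) := fun a => by
    simpa using (he.left a).sub (he.right a)
  have σ_l : ∀ a f x, σ (MW.dual.l a f) x = σ f (M.r a x) := fun a f x => by
    have h1 := (hσ (MW.dual.l a f) x).sub (hσ f (M.r a x))
    have h2 : Tendsto (fun i => (MW.dual.l a f) (p i x) - f (p i (M.r a x))) lf (𝓝 0) := by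
      have h3 : Tendsto (fun i => M.l (e i) (M.r (e i * a - a * e i) x)) lf (𝓝 0) := by
        refine tendsto_bdd_apply_zero (fun i => M.l (e i)) _ bl _ ?_
        have hc : Continuous fun z => M.r z x := by fun_prop
        have h9 := (hc.tendsto 0).comp (comm0 a)
        rw [map_zero, ContinuousLinearMap.zero_apply] at h9
        exact h9
      have h4 : Tendsto (fun i => rW a (p i x) - p i (M.r a x)) lf (𝓝 0) := by
        refine tendsto_subtype_rng.2 (h3.congr fun i => Eq.symm ?_)
        rw [Submodule.coe_sub, rW_coe, p_coe, p_coe, map_sub, ContinuousLinearMap.sub_apply,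
          M.r_mul, M.r_mul, map_sub, M.lr (e i) a]
      have h5 := (f.continuous.tendsto 0).comp h4
      rw [map_zero] at h5
      refine h5.congr fun i => ?_
      simp only [Function.comp, map_sub]
      rfl
    exact sub_eq_zero.1 (tendsto_nhds_unique h1 (h2.mono_left hU))
  have σ_r : ∀ a f x, σ (MW.dual.r a f) x = σ f (M.l a x) := fun a f x => by
    have h1 := (hσ (MW.dual.r a f) x).sub (hσ f (M.l a x))
    have h2 : Tendsto (fun i => (MW.dual.r a f) (p i x) - f (p i (M.l a x))) lf (𝓝 0) := by
      have h3 : Tendsto (fun i => M.r (e i) (M.l (a * e i - e i * a) x)) lf (𝓝 0) := by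
        refine tendsto_bdd_apply_zero (fun i => M.r (e i)) _ br _ ?_
        have hc : Continuous fun z => M.l z x := by fun_prop
        have := (comm0 a).neg
        simp only [neg_sub, neg_zero] at this
        have h9 := (hc.tendsto 0).comp this
        rw [map_zero, ContinuousLinearMap.zero_apply] at h9
        exact h9
      have h4 : Tendsto (fun i => lW a (p i x) - p i (M.l a x)) lf (𝓝 0) := by
        refine tendsto_subtype_rng.2 (h3.congr fun i => Eq.symm ?_)
        rw [Submodule.coe_sub, lW_coe, p_coe, p_coe, map_sub, ContinuousLinearMap.sub_apply,
          M.l_mul, M.l_mul, map_sub, M.lr (e i) (e i), M.lr a (e i), M.lr (e i) (e i)]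
      have h5 := (f.continuous.tendsto 0).comp h4
      rw [map_zero] at h5
      refine h5.congr fun i => ?_
      simp only [Function.comp, map_sub]
      rfl
    exact sub_eq_zero.1 (tendsto_nhds_unique h1 (h2.mono_left hU))
  -- the complementary derivation
  let D2 : C₀ →L[ℂ] (X →L[ℂ] ℂ) := D - σ ∘L (res ∘L D)
  have D2_apply : ∀ a x, D2 a x = D a x - σ (res (D a)) x := fun a x => rfl
  have hD2 : ∀ a b x, D2 (a * b) x = D2 b (M.r a x) + D2 a (M.l b x) := fun a b x => by
    have : res (D (a * b)) = MW.dual.l a (res (D b)) + MW.dual.r b (res (D a)) := by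
      ext w
      exact hD' a b w
    rw [D2_apply, D2_apply, D2_apply, this, map_add, ContinuousLinearMap.add_apply, σ_l, σ_r, hD']
    ring
  have hD2W : ∀ a, ∀ x ∈ W, D2 a x = 0 := fun a x hx => by
    rw [D2_apply, σ_res _ ⟨x, hx⟩, res_apply, sub_self]
  have bD2 : ∀ i, ‖D2 (e i)‖ ≤ ‖D2‖ * K := fun i => D2.le_opNorm_of_le (he.bdd i)
  obtain ⟨ξ, -, hξ⟩ := limOp1 (lf := (U : Filter ι)) (fun i => D2 (e i)) _ bD2 (fun x =>
    exists_ulim U _ (‖D2‖ * K * ‖x‖) (fun i => ContinuousLinearMap.le_of_opNorm_le _ (bD2 i) x))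
  have hξW : ∀ x ∈ W, ξ x = 0 := fun x hx => by
    refine tendsto_nhds_unique (hξ x) ?_
    simp [hD2W _ x hx]
  have hD2c : ∀ x, Continuous fun z => D2 z x := fun x => by fun_prop
  have ξr : ∀ a b x, ξ (M.r (a * b) x) = D2 b (M.r a x) := fun a b x => by
    refine tendsto_nhds_unique (hξ _) ?_
    have : Tendsto (fun i => D2 (b * e i) (M.r a x)) lf (𝓝 (D2 b (M.r a x))) :=
      ((hD2c (M.r a x)).tendsto b).comp (he.right b)
    refine (this.mono_left hU).congr fun i => ?_
    rw [hD2, hD2W b _ (hWlr _ _ _), add_zero, M.r_mul]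
  have ξl : ∀ a b x, ξ (M.l (a * b) x) = D2 a (M.l b x) := fun a b x => by
    refine tendsto_nhds_unique (hξ _) ?_
    have : Tendsto (fun i => D2 (e i * a) (M.l b x)) lf (𝓝 (D2 a (M.l b x))) :=
      ((hD2c (M.l b x)).tendsto a).comp (he.left a)
    refine (this.mono_left hU).congr fun i => ?_
    rw [hD2, ← M.lr, hD2W a _ (hWlr _ _ _), zero_add, M.l_mul]
  have key : ∀ a x, D2 a x = ξ (M.r a x) + ξ (M.l a x) := fun a x => by
    have h1 : Tendsto (fun i => D2 (a * e i) x) lf (𝓝 (D2 a x)) :=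
      ((hD2c x).tendsto a).comp (he.right a)
    have hc : Continuous fun z => ξ (M.r z x) + ξ (M.l z x) := by fun_prop
    have h2 := (hc.tendsto a).comp (he.right a)
    refine tendsto_nhds_unique h1 (h2.congr fun i => ?_)
    simp only [Function.comp]
    rw [ξr, ξl, hD2]
  have bρ : ∀ i, ‖ξ ∘L M.l (e i)‖ ≤ ‖ξ‖ * (‖M.l‖ * K) := fun i => by
    refine (ContinuousLinearMap.opNorm_comp_le _ _).trans ?_
    gcongr
    exact bl i
  obtain ⟨ρ, -, hρ⟩ := limOp1 (lf := (U : Filter ι)) (fun i => ξ ∘L M.l (e i)) _ bρ (fun x =>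
    exists_ulim U _ (‖ξ‖ * (‖M.l‖ * K) * ‖x‖)
      (fun i => ContinuousLinearMap.le_of_opNorm_le _ (bρ i) x))
  have ρr : ∀ a x, ρ (M.r a x) = 0 := fun a x => by
    refine tendsto_nhds_unique (hρ _) ?_
    simp [hξW _ (hWlr _ _ _)]
  have ρl : ∀ a x, ρ (M.l a x) = ξ (M.l a x) := fun a x => by
    refine tendsto_nhds_unique (hρ _) ?_
    exact ((ξ.continuous.tendsto _).comp (cll a x)).mono_left hU
  refine ⟨κ, lk, fun k => σ (φ k) + (ξ - (2 : ℂ) • ρ), hk, fun a => ?_⟩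
  have h1 := (((σ.continuous.tendsto _).comp (hφ a)).add_const (D2 a))
  have h2 : σ ((res ∘L D) a) + D2 a = D a := by
    ext x
    rw [ContinuousLinearMap.add_apply, D2_apply]
    simp
  rw [h2] at h1
  refine h1.congr fun k => ?_
  ext x
  simp only [Function.comp, map_sub, ContinuousLinearMap.add_apply,
    ContinuousLinearMap.sub_apply, dual_l_apply, dual_r_apply, σ_l, σ_r, key,
    ContinuousLinearMap.smul_apply, ρr, ρl, smul_eq_mul]
  ring

end abstractPart

section tensorPart

namespace ProjTensor

variable {A B C : Type*} [NonUnitalNormedRing A] [NormedSpace ℂ A]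
    [NonUnitalNormedRing B] [NormedSpace ℂ B]
    [NonUnitalNormedRing C] [NormedSpace ℂ C]

theorem induct (t : ProjTensor A B C) {P : C → Prop} (hc : IsClosed {x | P x})
    (hadd : ∀ x y, P x → P y → P (x + y)) (htp : ∀ a b, P (t.tp a b)) (x : C) : P x := by
  have h1 : ∀ x ∈ Submodule.span ℂ (Set.range fun p : A × B => t.tp p.1 p.2),
      ∀ z : ℂ, P (z • x) := by
    intro x hx
    induction hx using Submodule.span_induction with
    | mem x hx =>
      obtain ⟨p, rfl⟩ := hx
      intro z
      have := htp (z • p.1) p.2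
      simpa using this
    | zero => intro z; simpa using htp 0 0
    | add x y _ _ hx hy => intro z; rw [smul_add]; exact hadd _ _ (hx z) (hy z)
    | smul c x _ hx => intro z; rw [smul_smul]; exact hx _
  have h2 := hc.closure_subset_iff.2 (fun x hx => by simpa using h1 x hx 1 :
    ((Submodule.span ℂ (Set.range fun p : A × B => t.tp p.1 p.2) : Submodule ℂ C) : Set C)
      ⊆ {x | P x})
  exact h2 (t.dense_span x)

theorem ext_clm (t : ProjTensor A B C) {E : Type*} [NormedAddCommGroup E] [NormedSpace ℂ E]
    {S T : C →L[ℂ] E} (h : ∀ a b, S (t.tp a b) = T (t.tp a b)) : S = T := by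
  ext x
  refine t.induct (P := fun x => S x = T x) (isClosed_eq S.continuous T.continuous)
    (fun x y hx hy => ?_) h x
  rw [map_add, map_add, hx, hy]

/-- the universal property in every universe -/
theorem exists_lift (t : ProjTensor A B C) {E : Type*} [NormedAddCommGroup E] [NormedSpace ℂ E]
    [CompleteSpace E] (φ : A →L[ℂ] B →L[ℂ] E) :
    ∃ T : C →L[ℂ] E, ‖T‖ ≤ ‖φ‖ ∧ ∀ a b, T (t.tp a b) = φ a b := by
  have h0 : ∀ g : StrongDual ℂ E, ∃ T : C →L[ℂ] ℂ, ‖T‖ ≤ ‖φ‖ * ‖g‖ ∧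
      ∀ a b, T (t.tp a b) = g (φ a b) := fun g => by
    obtain ⟨T, hT, hT'⟩ := t.lift ℂ ((ContinuousLinearMap.compL ℂ B E ℂ g) ∘L φ)
    refine ⟨T, hT.trans ?_, fun a b => hT' a b⟩
    refine ContinuousLinearMap.opNorm_le_bound₂ _ (by positivity) fun a b => ?_
    calc ‖g (φ a b)‖ ≤ ‖g‖ * (‖φ‖ * ‖a‖ * ‖b‖) := g.le_opNorm_of_le (φ.le_opNorm₂ a b)
      _ = _ := by ring
  choose T hT hT' using h0
  let G : StrongDual ℂ E →ₗ[ℂ] (C →L[ℂ] ℂ) :=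
    { toFun := T
      map_add' := fun f g => t.ext_clm fun a b => by simp [hT']
      map_smul' := fun c g => t.ext_clm fun a b => by simp [hT'] }
  let G' : StrongDual ℂ E →L[ℂ] (C →L[ℂ] ℂ) := G.mkContinuous ‖φ‖ hT
  let H : C →L[ℂ] StrongDual ℂ (StrongDual ℂ E) := G'.flip
  have hH : ∀ a b, H (t.tp a b) = NormedSpace.inclusionInDoubleDual ℂ E (φ a b) := fun a b => by
    ext g
    exact hT' g a b
  have hHn : ∀ x, ‖H x‖ ≤ ‖φ‖ * ‖x‖ := fun x => by
    refine ContinuousLinearMap.opNorm_le_bound _ (by positivity) fun g => ?_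
    calc ‖T g x‖ ≤ ‖φ‖ * ‖g‖ * ‖x‖ := (T g).le_of_opNorm_le (hT g) x
      _ = _ := by ring
  let I : E →ₗᵢ[ℂ] StrongDual ℂ (StrongDual ℂ E) := NormedSpace.inclusionInDoubleDualLi ℂ
  have hI : ∀ v, I v = NormedSpace.inclusionInDoubleDual ℂ E v := fun v => rfl
  have hcl : IsClosed (Set.range I) := li_closed (X := E) (V := StrongDual ℂ (StrongDual ℂ E)) I
  have hr : ∀ x, ∃ v, I v = H x := fun x => by
    refine t.induct (P := fun x => ∃ v, I v = H x) ?_ ?_ ?_ x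
    · exact hcl.preimage H.continuous
    · rintro x y ⟨v, hv⟩ ⟨w, hw⟩
      exact ⟨v + w, by rw [map_add, map_add, hv, hw]⟩
    · intro a b
      exact ⟨φ a b, (hH a b).symm⟩
  choose s hs using hr
  let S : C →ₗ[ℂ] E :=
    { toFun := s
      map_add' := fun x y => I.injective (by simp [hs])
      map_smul' := fun c x => I.injective (by simp [hs]) }
  have hφ0 : 0 ≤ ‖φ‖ := by positivity
  refine ⟨S.mkContinuous ‖φ‖ fun x => ?_, S.mkContinuous_norm_le hφ0 _, fun a b => ?_⟩
  · change ‖s x‖ ≤ _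
    rw [← I.norm_map, hs]
    exact hHn x
  · refine I.injective ?_
    change I (s _) = _
    rw [hs, hH]
    rfl

theorem exists_liftL (t : ProjTensor A B C) (E : Type*) [NormedAddCommGroup E] [NormedSpace ℂ E]
    [CompleteSpace E] : ∃ Λ : (A →L[ℂ] B →L[ℂ] E) →L[ℂ] (C →L[ℂ] E),
      ∀ φ a b, Λ φ (t.tp a b) = φ a b := by
  choose T hT hT' using fun φ : A →L[ℂ] B →L[ℂ] E => t.exists_lift φ
  let G : (A →L[ℂ] B →L[ℂ] E) →ₗ[ℂ] (C →L[ℂ] E) :=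
    { toFun := T
      map_add' := fun f g => t.ext_clm fun a b => by simp [hT']
      map_smul' := fun c g => t.ext_clm fun a b => by simp [hT'] }
  exact ⟨LinearMap.mkContinuous (E := A →L[ℂ] B →L[ℂ] E) (F := C →L[ℂ] E) G 1 (fun φ => by rw [one_mul]; exact hT φ), hT'⟩

/-- Tensoring two (families of) operators. -/
theorem exists_tensorOp {A' B' C' : Type*} [NonUnitalNormedRing A'] [NormedSpace ℂ A']
    [NonUnitalNormedRing B'] [NormedSpace ℂ B']
    [NonUnitalNormedRing C'] [NormedSpace ℂ C'] [CompleteSpace C]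
    (t' : ProjTensor A' B' C') (t : ProjTensor A B C)
    (S : A' →L[ℂ] A →L[ℂ] A) (T : B' →L[ℂ] B →L[ℂ] B) :
    ∃ Λ : C' →L[ℂ] C →L[ℂ] C, ∀ a' b' a b,
      Λ (t'.tp a' b') (t.tp a b) = t.tp (S a' a) (T b' b) := by
  obtain ⟨L, hL⟩ := ProjTensor.exists_liftL t C
  have hpost := exists_post (F := A) (X := B) (V := C) (P := A') (Q := B')
    (Z := C →L[ℂ] C) S T t.tp L
  obtain ⟨G, hG⟩ := hpost
  obtain ⟨Λ, -, hΛ⟩ := t'.exists_lift (E := C →L[ℂ] C) G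
  refine ⟨Λ, fun a' b' a b => ?_⟩
  obtain ⟨φ, h1, h2⟩ := hG a' b'
  rw [hΛ, h1, hL, h2]

end ProjTensor

theorem IsUnitization.exists_acts {A A' : Type*} [NonUnitalNormedRing A] [NormedSpace ℂ A]
    [NormedRing A'] [NormedAlgebra ℂ A'] (u : IsUnitization A A') :
    ∃ S T : A' →L[ℂ] A →L[ℂ] A, (∀ x a, u.ι (S x a) = x * u.ι a) ∧
      (∀ x a, u.ι (T x a) = u.ι a * x) := by
  have inj : Function.Injective u.ι := by
    intro a b hab
    have h := u.ι_norm (a - b)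
    rw [map_sub, hab, sub_self, norm_zero] at h
    exact sub_eq_zero.1 (norm_eq_zero.1 h.symm)
  have hl : ∀ (x : A') (a : A), ∃ c, u.ι c = x * u.ι a := fun x a => by
    obtain ⟨p, hp, -⟩ := u.decomp x
    refine ⟨p.1 • a + p.2 * a, ?_⟩
    rw [hp, map_add, map_smul, u.ι_mul, add_mul, Algebra.smul_def]
  have hr : ∀ (x : A') (a : A), ∃ c, u.ι c = u.ι a * x := fun x a => by
    obtain ⟨p, hp, -⟩ := u.decomp x
    refine ⟨p.1 • a + a * p.2, ?_⟩
    rw [hp, map_add, map_smul, u.ι_mul, mul_add, Algebra.smul_def, Algebra.commutes]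
  choose s hs using hl
  choose r hr using hr
  refine ⟨LinearMap.mkContinuous₂ (LinearMap.mk₂ ℂ s
      (fun x y a => inj (by simp [hs, add_mul])) (fun c x a => inj (by simp [hs]))
      (fun x a b => inj (by simp [hs, mul_add])) (fun c x a => inj (by simp [hs]))) 1
      (fun x a => ?_),
    LinearMap.mkContinuous₂ (LinearMap.mk₂ ℂ r
      (fun x y a => inj (by simp [hr, mul_add])) (fun c x a => inj (by simp [hr]))
      (fun x a b => inj (by simp [hr, add_mul])) (fun c x a => inj (by simp [hr]))) 1
      (fun x a => ?_), fun x a => hs x a, fun x a => hr x a⟩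
  · change ‖s x a‖ ≤ _
    rw [← u.ι_norm, hs, one_mul]
    exact (norm_mul_le _ _).trans (by rw [u.ι_norm])
  · change ‖r x a‖ ≤ _
    rw [← u.ι_norm, hr, one_mul, mul_comm ‖x‖]
    exact (norm_mul_le _ _).trans (by rw [u.ι_norm])

theorem ProjTensor.exists_bai {A B C : Type*} [NonUnitalNormedRing A] [NormedSpace ℂ A]
    [NonUnitalNormedRing B] [NormedSpace ℂ B]
    [NonUnitalNormedRing C] [NormedSpace ℂ C] (t : ProjTensor A B C)
    (hA : HasBAI A) (hB : HasBAI B) :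
    ∃ (ι : Type) (lf : Filter ι) (e : ι → C) (K : ℝ), lf.NeBot ∧ BAI lf e K := by
  obtain ⟨ι, lf, e, K, hn, hK, he⟩ := hA
  obtain ⟨κ, lg, f, K', hn', hK', hf⟩ := hB
  have hK0 : 0 ≤ K := by
    obtain ⟨i⟩ := lf.nonempty_of_neBot
    exact (norm_nonneg _).trans (hK i)
  have hb : ∀ p : ι × κ, ‖t.tp (e p.1) (f p.2)‖ ≤ K * K' := fun p =>
    (t.norm_mk_le _ _).trans (mul_le_mul (hK _) (hK' _) (norm_nonneg _) hK0)
  have hKK : 0 ≤ K * K' := by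
    obtain ⟨i⟩ := (lf ×ˢ lg).nonempty_of_neBot
    exact (norm_nonneg _).trans (hb i)
  have cont2 : Continuous fun q : A × B => t.tp q.1 q.2 := by fun_prop
  have closed_aux : ∀ (T : ι × κ → C →+ C), (∀ i x, ‖T i x‖ ≤ K * K' * ‖x‖) →
      IsClosed {x | Tendsto (fun i => T i x) (lf ×ˢ lg) (𝓝 x)} := by
    intro T hB
    refine isClosed_of_closure_subset fun x hx => ?_
    change Tendsto _ _ _
    rw [Metric.tendsto_nhds]
    intro ε hε
    obtain ⟨y, hy, hxy⟩ := Metric.mem_closure_iff.1 hx (ε / (2 * (K * K' + 1))) (by positivity)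
    have h2 : (K * K' + 1) * dist x y < ε / 2 := by
      calc (K * K' + 1) * dist x y < (K * K' + 1) * (ε / (2 * (K * K' + 1))) := by gcongr
        _ = ε / 2 := by field_simp
    filter_upwards [Metric.tendsto_nhds.1 hy (ε / 2) (by positivity)] with i hi
    have h1 : dist (T i x) (T i y) ≤ K * K' * dist x y := by
      rw [dist_eq_norm, ← map_sub, dist_eq_norm]
      exact hB i _
    have h3 := dist_triangle4 (T i x) (T i y) y x
    rw [dist_comm y x] at h3
    linarith
  refine ⟨ι × κ, lf ×ˢ lg, fun p => t.tp (e p.1) (f p.2), K * K', inferInstance, hb, ?_, ?_⟩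
  · refine t.induct (closed_aux (fun p => AddMonoidHom.mulLeft (t.tp (e p.1) (f p.2)))
      fun i x => (norm_mul_le _ _).trans (by gcongr; exact hb i)) ?_ ?_
    · intro x y hx hy
      simpa [mul_add] using hx.add hy
    · intro a b
      simp only [← t.mk_mul]
      exact (cont2.tendsto (a, b)).comp
        (((he a).1.comp tendsto_fst).prodMk_nhds ((hf b).1.comp tendsto_snd))
  · refine t.induct (closed_aux (fun p => AddMonoidHom.mulRight (t.tp (e p.1) (f p.2)))
      fun i x => (norm_mul_le _ _).trans (by rw [mul_comm]; gcongr; exact hb i)) ?_ ?_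
    · intro x y hx hy
      simpa [add_mul] using hx.add hy
    · intro a b
      simp only [← t.mk_mul]
      exact (cont2.tendsto (a, b)).comp
        (((he a).2.comp tendsto_fst).prodMk_nhds ((hf b).2.comp tendsto_snd))

end tensorPart

/-- if `A# ⊗̂ B#` is approximately amenable and `A`, `B` have bounded
approximate identities, then `A ⊗̂ B` is approximately amenable. -/
theorem approxAmenable_tensor_of_unitization_tensor_of_bai
    {A B A' B' C C₀ : Type*}
    [NonUnitalNormedRing A] [NormedSpace ℂ A] [CompleteSpace A]
    [NonUnitalNormedRing B] [NormedSpace ℂ B] [CompleteSpace B]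
    [NormedRing A'] [NormedAlgebra ℂ A'] [CompleteSpace A']
    [NormedRing B'] [NormedAlgebra ℂ B'] [CompleteSpace B']
    [NonUnitalNormedRing C] [NormedSpace ℂ C] [CompleteSpace C]
    [NonUnitalNormedRing C₀] [NormedSpace ℂ C₀] [CompleteSpace C₀]
    (uA : IsUnitization A A') (uB : IsUnitization B B')
    (t : ProjTensor A' B' C)
    (t₀ : ProjTensor A B C₀)
    (hA : HasBAI A) (hB : HasBAI B)
    (h : ApproxAmenable C) : ApproxAmenable C₀ := by
  obtain ⟨ι, lf, e, K, hn, he⟩ := t₀.exists_bai hA hB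
  obtain ⟨SA, TA, hSA, hTA⟩ := uA.exists_acts
  obtain ⟨SB, TB, hSB, hTB⟩ := uB.exists_acts
  obtain ⟨L, hL⟩ := t.exists_tensorOp t₀ SA SB
  obtain ⟨R, hR⟩ := t.exists_tensorOp t₀ TA TB
  obtain ⟨J, -, hJ⟩ := t₀.exists_lift (t.tp.bilinearComp uA.ι uB.ι)
  have injA : Function.Injective uA.ι := by
    intro a b hab
    have h := uA.ι_norm (a - b)
    rw [map_sub, hab, sub_self, norm_zero] at h
    exact sub_eq_zero.1 (norm_eq_zero.1 h.symm)
  have injB : Function.Injective uB.ι := by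
    intro a b hab
    have h := uB.ι_norm (a - b)
    rw [map_sub, hab, sub_self, norm_zero] at h
    exact sub_eq_zero.1 (norm_eq_zero.1 h.symm)
  -- induction principle for pairs of continuous biadditive expressions
  have ind3 : ∀ (F G : C → C → C₀ → C₀),
      (∀ b x, Continuous fun a => F a b x) → (∀ b x, Continuous fun a => G a b x) →
      (∀ a x, Continuous fun b => F a b x) → (∀ a x, Continuous fun b => G a b x) →
      (∀ a b, Continuous fun x => F a b x) → (∀ a b, Continuous fun x => G a b x) →
      (∀ a a' b x, F (a + a') b x = F a b x + F a' b x) →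
      (∀ a a' b x, G (a + a') b x = G a b x + G a' b x) →
      (∀ a b b' x, F a (b + b') x = F a b x + F a b' x) →
      (∀ a b b' x, G a (b + b') x = G a b x + G a b' x) →
      (∀ a b x x', F a b (x + x') = F a b x + F a b x') →
      (∀ a b x x', G a b (x + x') = G a b x + G a b x') →
      (∀ a₁ a₂ b₁ b₂ x₁ x₂, F (t.tp a₁ a₂) (t.tp b₁ b₂) (t₀.tp x₁ x₂) =
        G (t.tp a₁ a₂) (t.tp b₁ b₂) (t₀.tp x₁ x₂)) → ∀ a b x, F a b x = G a b x := by
    intro F G c1 c1' c2 c2' c3 c3' d1 d1' d2 d2' d3 d3' H a b x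
    refine t.induct (P := fun a => F a b x = G a b x) (isClosed_eq (c1 b x) (c1' b x))
      (fun u v hu hv => by rw [d1, d1', hu, hv]) (fun a₁ a₂ => ?_) a
    refine t.induct (P := fun b => F _ b x = G _ b x) (isClosed_eq (c2 _ x) (c2' _ x))
      (fun u v hu hv => by rw [d2, d2', hu, hv]) (fun b₁ b₂ => ?_) b
    exact t₀.induct (P := fun x => F _ _ x = G _ _ x) (isClosed_eq (c3 _ _) (c3' _ _))
      (fun u v hu hv => by rw [d3, d3', hu, hv]) (fun x₁ x₂ => H _ _ _ _ _ _) x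
  have ind3' : ∀ (F G : C → C₀ → C₀ → C₀),
      (∀ b x, Continuous fun a => F a b x) → (∀ b x, Continuous fun a => G a b x) →
      (∀ a x, Continuous fun b => F a b x) → (∀ a x, Continuous fun b => G a b x) →
      (∀ a b, Continuous fun x => F a b x) → (∀ a b, Continuous fun x => G a b x) →
      (∀ a a' b x, F (a + a') b x = F a b x + F a' b x) →
      (∀ a a' b x, G (a + a') b x = G a b x + G a' b x) →
      (∀ a b b' x, F a (b + b') x = F a b x + F a b' x) →
      (∀ a b b' x, G a (b + b') x = G a b x + G a b' x) →
      (∀ a b x x', F a b (x + x') = F a b x + F a b x') →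
      (∀ a b x x', G a b (x + x') = G a b x + G a b x') →
      (∀ a₁ a₂ b₁ b₂ x₁ x₂, F (t.tp a₁ a₂) (t₀.tp b₁ b₂) (t₀.tp x₁ x₂) =
        G (t.tp a₁ a₂) (t₀.tp b₁ b₂) (t₀.tp x₁ x₂)) → ∀ a b x, F a b x = G a b x := by
    intro F G c1 c1' c2 c2' c3 c3' d1 d1' d2 d2' d3 d3' H a b x
    refine t.induct (P := fun a => F a b x = G a b x) (isClosed_eq (c1 b x) (c1' b x))
      (fun u v hu hv => by rw [d1, d1', hu, hv]) (fun a₁ a₂ => ?_) a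
    refine t₀.induct (P := fun b => F _ b x = G _ b x) (isClosed_eq (c2 _ x) (c2' _ x))
      (fun u v hu hv => by rw [d2, d2', hu, hv]) (fun b₁ b₂ => ?_) b
    exact t₀.induct (P := fun x => F _ _ x = G _ _ x) (isClosed_eq (c3 _ _) (c3' _ _))
      (fun u v hu hv => by rw [d3, d3', hu, hv]) (fun x₁ x₂ => H _ _ _ _ _ _) x
  have ind2 : ∀ (F G : C₀ → C₀ → C₀),
      (∀ x, Continuous fun b => F b x) → (∀ x, Continuous fun b => G b x) →
      (∀ b, Continuous fun x => F b x) → (∀ b, Continuous fun x => G b x) →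
      (∀ b b' x, F (b + b') x = F b x + F b' x) →
      (∀ b b' x, G (b + b') x = G b x + G b' x) →
      (∀ b x x', F b (x + x') = F b x + F b x') →
      (∀ b x x', G b (x + x') = G b x + G b x') →
      (∀ b₁ b₂ x₁ x₂, F (t₀.tp b₁ b₂) (t₀.tp x₁ x₂) =
        G (t₀.tp b₁ b₂) (t₀.tp x₁ x₂)) → ∀ b x, F b x = G b x := by
    intro F G c2 c2' c3 c3' d2 d2' d3 d3' H b x
    refine t₀.induct (P := fun b => F b x = G b x) (isClosed_eq (c2 x) (c2' x))
      (fun u v hu hv => by rw [d2, d2', hu, hv]) (fun b₁ b₂ => ?_) b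
    exact t₀.induct (P := fun x => F _ x = G _ x) (isClosed_eq (c3 _) (c3' _))
      (fun u v hu hv => by rw [d3, d3', hu, hv]) (fun x₁ x₂ => H _ _ _ _) x
  let N : BBimod C C₀ :=
    { l := L
      r := R
      l_mul := by
        refine ind3 (fun a b x => L (a * b) x) (fun a b x => L a (L b x)) ?_ ?_ ?_ ?_ ?_ ?_
          ?_ ?_ ?_ ?_ ?_ ?_ ?_
        iterate 6 (intros; fun_prop)
        iterate 6 (intros; simp [mul_add, add_mul])
        intro a₁ a₂ b₁ b₂ x₁ x₂
        simp only [← t.mk_mul, hL]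
        refine congrArg₂ (fun a b => t₀.tp a b) ?_ ?_
        · exact injA (by simp [hSA, mul_assoc])
        · exact injB (by simp [hSB, mul_assoc])
      r_mul := by
        refine ind3 (fun a b x => R (a * b) x) (fun a b x => R b (R a x)) ?_ ?_ ?_ ?_ ?_ ?_
          ?_ ?_ ?_ ?_ ?_ ?_ ?_
        iterate 6 (intros; fun_prop)
        iterate 6 (intros; simp [mul_add, add_mul])
        intro a₁ a₂ b₁ b₂ x₁ x₂
        simp only [← t.mk_mul, hR]
        refine congrArg₂ (fun a b => t₀.tp a b) ?_ ?_
        · exact injA (by simp [hTA, mul_assoc])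
        · exact injB (by simp [hTB, mul_assoc])
      lr := by
        refine ind3 (fun a b x => L a (R b x)) (fun a b x => R b (L a x)) ?_ ?_ ?_ ?_ ?_ ?_
          ?_ ?_ ?_ ?_ ?_ ?_ ?_
        iterate 6 (intros; fun_prop)
        iterate 6 (intros; simp)
        intro a₁ a₂ b₁ b₂ x₁ x₂
        simp only [hL, hR]
        refine congrArg₂ (fun a b => t₀.tp a b) ?_ ?_
        · exact injA (by simp [hSA, hTA, mul_assoc])
        · exact injB (by simp [hSB, hTB, mul_assoc]) }
  refine abstract_main he (N := N) (J := J) ⟨?_, ?_, ?_, ?_, ?_⟩ h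
  · refine ind3' (fun c x y => L c (x * y)) (fun c x y => L c x * y) ?_ ?_ ?_ ?_ ?_ ?_
      ?_ ?_ ?_ ?_ ?_ ?_ ?_
    iterate 6 (intros; fun_prop)
    iterate 6 (intros; simp [mul_add, add_mul])
    intro a₁ a₂ b₁ b₂ x₁ x₂
    simp only [hL, ← t₀.mk_mul]
    refine congrArg₂ (fun a b => t₀.tp a b) ?_ ?_
    · exact injA (by simp [hSA, uA.ι_mul, mul_assoc])
    · exact injB (by simp [hSB, uB.ι_mul, mul_assoc])
  · refine ind3' (fun c x y => R c (x * y)) (fun c x y => x * R c y) ?_ ?_ ?_ ?_ ?_ ?_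
      ?_ ?_ ?_ ?_ ?_ ?_ ?_
    iterate 6 (intros; fun_prop)
    iterate 6 (intros; simp [mul_add, add_mul])
    intro a₁ a₂ b₁ b₂ x₁ x₂
    simp only [hR, ← t₀.mk_mul]
    refine congrArg₂ (fun a b => t₀.tp a b) ?_ ?_
    · exact injA (by simp [hTA, uA.ι_mul, mul_assoc])
    · exact injB (by simp [hTB, uB.ι_mul, mul_assoc])
  · refine ind3' (fun c x y => x * L c y) (fun c x y => R c x * y) ?_ ?_ ?_ ?_ ?_ ?_
      ?_ ?_ ?_ ?_ ?_ ?_ ?_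
    iterate 6 (intros; fun_prop)
    iterate 6 (intros; simp [mul_add, add_mul])
    intro a₁ a₂ b₁ b₂ x₁ x₂
    simp only [hL, hR, ← t₀.mk_mul]
    refine congrArg₂ (fun a b => t₀.tp a b) ?_ ?_
    · exact injA (by simp [hTA, hSA, uA.ι_mul, mul_assoc])
    · exact injB (by simp [hTB, hSB, uB.ι_mul, mul_assoc])
  · refine ind2 (fun x y => L (J x) y) (fun x y => x * y) ?_ ?_ ?_ ?_ ?_ ?_ ?_ ?_ ?_
    iterate 4 (intros; fun_prop)
    iterate 4 (intros; simp [mul_add, add_mul])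
    intro b₁ b₂ x₁ x₂
    simp only [hJ, ContinuousLinearMap.bilinearComp_apply, hL, ← t₀.mk_mul]
    refine congrArg₂ (fun a b => t₀.tp a b) ?_ ?_
    · exact injA (by simp [hSA, uA.ι_mul])
    · exact injB (by simp [hSB, uB.ι_mul])
  · refine ind2 (fun x y => R (J x) y) (fun x y => y * x) ?_ ?_ ?_ ?_ ?_ ?_ ?_ ?_ ?_
    iterate 4 (intros; fun_prop)
    iterate 4 (intros; simp [mul_add, add_mul])
    intro b₁ b₂ x₁ x₂
    simp only [hJ, ContinuousLinearMap.bilinearComp_apply, hR, ← t₀.mk_mul]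
    refine congrArg₂ (fun a b => t₀.tp a b) ?_ ?_
    · exact injA (by simp [hTA, uA.ι_mul])
    · exact injB (by simp [hTB, uB.ι_mul])
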